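/- arXiv:2310.09065 — 7 statements merged into one kernel-verified Lean document; each statement's English description precedes it below -/
import Mathlib

section
/- Let f : X → S be a finite type dominant morphism of schemes, where S is an integral noetherian scheme and X is an irreducible scheme with no embedded points. Let t ∈ Γ(X, O_X) be a global section such that, for a dense set of points s ∈ S, the pullback of t to the fiber X_s is zero. Then t = 0. -/
open AlgebraicGeometry CategoryTheory CategoryTheory.Limits

/-- A scheme `X` has *no embedded points* if for every affine open `U ⊆ X`, every associated
prime of the ring `Γ(X, U)` (as a module over itself) is a minimal prime of `Γ(X, U)`. -/
def AlgebraicGeometry.Scheme.NoEmbeddedPoints (X : AlgebraicGeometry.Scheme) : Prop :=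
  ∀ U : X.affineOpens, ∀ p ∈ associatedPrimes Γ(X, U.1) Γ(X, U.1),
    p ∈ minimalPrimes Γ(X, U.1)

open scoped TensorProduct Pointwise

theorem exists_ideal_notMem_finite_quotient (K : Type*) {E : Type*} [Field K] [CommRing E]
    [Algebra K E] [Algebra.FiniteType K E] {x : E} (hx : x ≠ 0) :
    ∃ J : Ideal E, x ∉ J ∧ Module.Finite K (E ⧸ J) := by
  have : IsNoetherianRing E := Algebra.FiniteType.isNoetherianRing K E
  obtain ⟨m, hm, hxm⟩ := Ideal.exists_le_maximal (Ideal.span {x}).annihilator (by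
    rw [Ne, Submodule.annihilator_eq_top_iff, Submodule.eq_bot_iff]
    exact fun h => hx (h x (Ideal.mem_span_singleton_self x)))
  obtain ⟨n, hn⟩ : ∃ n, x ∉ m ^ n := by
    by_contra! H
    obtain ⟨r, hr⟩ := (m.mem_iInf_smul_pow_eq_bot_iff x).mp (by simpa using H)
    have h1 : 1 - (r : E) ∈ m := hxm (by
      rw [Submodule.mem_annihilator_span_singleton, sub_smul, hr, one_smul, sub_self])
    exact hm.ne_top ((Ideal.eq_top_iff_one m).mpr (by simpa using add_mem h1 r.2))
  refine ⟨m ^ n, hn, ?_⟩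
  have : Ring.KrullDimLE 0 (E ⧸ m ^ n) := Ring.KrullDimLE.mk₀ fun p hp => by
    have hle : m ≤ p.comap (Ideal.Quotient.mk (m ^ n)) :=
      Ideal.IsPrime.le_of_pow_le (n := n) fun y hy => by
        rw [Ideal.mem_comap, Ideal.Quotient.eq_zero_iff_mem.mpr hy]
        exact p.zero_mem
    have hmax : (p.comap (Ideal.Quotient.mk (m ^ n))).IsMaximal := by
      rwa [← hm.eq_of_le (Ideal.IsPrime.ne_top inferInstance) hle]
    rw [← Ideal.map_comap_of_surjective _ Ideal.Quotient.mk_surjective p]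
    refine (Ideal.map_eq_top_or_isMaximal_of_surjective _ Ideal.Quotient.mk_surjective
      hmax).resolve_left fun h => hp.ne_top ?_
    rwa [Ideal.map_comap_of_surjective _ Ideal.Quotient.mk_surjective p] at h
  exact (Module.finite_iff_krullDimLE_zero K (E ⧸ m ^ n)).mpr this

theorem exists_linearMap_localizationAway_eq_one {A B : Type*} [CommRing A] [IsDomain A]
    [CommRing B] [Algebra A B] [Algebra.FiniteType A B] {t : B}
    (ht : (1 : FractionRing A) ⊗ₜ[A] t ≠ 0) :
    ∃ a : A, a ≠ 0 ∧ ∃ φ : B →ₗ[A] Localization.Away a, φ t = 1 := by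
  classical
  let K := FractionRing A
  obtain ⟨J, htJ, hJ⟩ := exists_ideal_notMem_finite_quotient K ht
  let D := (K ⊗[A] B) ⧸ J
  let g : B →ₐ[A] D := (Ideal.Quotient.mkₐ A J).comp Algebra.TensorProduct.includeRight
  have hgt : g t ≠ 0 := fun h => htJ (Ideal.Quotient.eq_zero_iff_mem.mp h)
  obtain ⟨φ, hφ⟩ : ∃ φ : Module.Dual K D, φ (g t) ≠ 0 := by
    by_contra! H
    exact hgt ((Module.forall_dual_apply_eq_zero_iff K _).mp H)
  have : Algebra.IsAlgebraic K D := inferInstance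
  have : Algebra.IsAlgebraic A D := (IsFractionRing.comap_isAlgebraic_iff (K := K)).mpr this
  obtain ⟨S, hS⟩ := (‹Algebra.FiniteType A B›).out
  obtain ⟨y, hy, hyS⟩ := Algebra.IsAlgebraic.exists_integral_multiples A (S.image g)
  let N : Subalgebra A D := Algebra.adjoin A ((y • S.image g : Finset D) : Set D)
  have hN : (Subalgebra.toSubmodule N).FG := fg_adjoin_of_finite (Finset.finite_toSet _) <| by
    intro x hx
    obtain ⟨z, hz, rfl⟩ := Finset.mem_smul_finset.mp hx
    exact hyS z hz
  have hpow (b : B) : ∃ n : ℕ, y ^ n • g b ∈ N := by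
    have hb : g b ∈ Algebra.adjoin A ((S.image g : Finset D) : Set D) := by
      rw [Finset.coe_image, ← AlgHom.map_adjoin, hS]
      exact ⟨b, trivial, rfl⟩
    obtain ⟨n, hn⟩ := Algebra.pow_smul_mem_of_smul_subset_of_mem_adjoin y _ N
      (by rw [← Finset.coe_smul_finset]; exact Algebra.subset_adjoin) hb (N.algebraMap_mem y)
    exact ⟨n, hn n le_rfl⟩
  let ψ : D →ₗ[A] K := ((φ (g t))⁻¹ • φ).restrictScalars A
  obtain ⟨G, hG⟩ := hN
  obtain ⟨d, hd⟩ := IsLocalization.exist_integer_multiples_of_finset (nonZeroDivisors A)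
    (G.image ψ)
  have hint (x : D) (hx : x ∈ N) : (d : A) • ψ x ∈ (1 : Submodule A K) := by
    have hle : Subalgebra.toSubmodule N ≤ (1 : Submodule A K).comap ((d : A) • ψ) := by
      rw [← hG, Submodule.span_le]
      intro z hz
      obtain ⟨r, hr⟩ := hd (ψ z) (Finset.mem_image_of_mem ψ hz)
      exact Submodule.mem_one.mpr ⟨r, hr⟩
    exact hle hx
  have hd0 : (d : A) ≠ 0 := nonZeroDivisors.coe_ne_zero d
  have ha : (d : A) * y ≠ 0 := mul_ne_zero hd0 hy
  refine ⟨d * y, ha, ?_⟩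
  let ι : Localization.Away ((d : A) * y) →ₐ[A] K :=
    IsLocalization.Away.liftAlgHom (x := (d : A) * y) (f := Algebra.ofId A K)
      (IsUnit.mk0 _ (by simpa [Algebra.ofId_apply] using ha))
  have hι : Function.Injective ι := by
    rw [← AlgHom.coe_toRingHom, IsLocalization.injective_iff_map_algebraMap_eq
      (Submonoid.powers ((d : A) * y))]
    intro x z
    have hinj : Function.Injective (algebraMap A (Localization.Away ((d : A) * y))) :=
      IsLocalization.injective _ (powers_le_nonZeroDivisors_of_noZeroDivisors ha)
    simp [hinj.eq_iff]
  have hrange (b : B) : ψ (g b) ∈ LinearMap.range ι.toLinearMap := by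
    obtain ⟨n, hn⟩ := hpow b
    obtain ⟨r, hr⟩ := Submodule.mem_one.mp (hint _ hn)
    let u : Submonoid.powers ((d : A) * y) :=
      ⟨(d * y) ^ (n + 1), pow_mem (Submonoid.mem_powers _) _⟩
    refine ⟨IsLocalization.mk' _ (r * (d : A) ^ n * y) u, ?_⟩
    have hne : algebraMap A K ((d * y) ^ (n + 1)) ≠ 0 := by
      simpa using ha
    refine mul_right_cancel₀ hne ?_
    rw [AlgHom.toLinearMap_apply, ← ι.commutes ((d * y) ^ (n + 1)), ← map_mul,
      show (d * y) ^ (n + 1) = (u : A) from rfl, IsLocalization.mk'_spec]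
    rw [LinearMap.map_smul, Algebra.smul_def, Algebra.smul_def] at hr
    simp only [AlgHom.commutes, map_mul, map_pow, hr, u]
    ring
  refine ⟨(LinearEquiv.ofInjective ι.toLinearMap hι).symm.toLinearMap ∘ₗ
    (ψ ∘ₗ g.toLinearMap).codRestrict _ hrange, ?_⟩
  simp only [LinearMap.coe_comp, LinearEquiv.coe_coe, Function.comp_apply]
  rw [LinearEquiv.symm_apply_eq]
  exact Subtype.ext ((inv_mul_cancel₀ hφ).trans (map_one ι).symm)

theorem one_tmul_ne_zero_of_linearMap_localizationAway {A B F : Type*} [CommRing A]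
    [CommRing B] [Algebra A B] [CommRing F] [Nontrivial F] [Algebra A F] {a : A}
    (ha : IsUnit (algebraMap A F a)) {t : B} (φ : B →ₗ[A] Localization.Away a)
    (hφ : φ t = 1) : (1 : F) ⊗ₜ[A] t ≠ 0 := by
  let l : Localization.Away a →ₐ[A] F :=
    IsLocalization.Away.liftAlgHom (x := a) (f := Algebra.ofId A F) ha
  intro h
  have := congrArg ((l.toLinearMap ∘ₗ φ).liftBaseChange F) h
  simp [hφ] at this

theorem mem_nonZeroDivisors_of_associatedPrimes_subset_minimalPrimes {B : Type*} [CommRing B]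
    [IsNoetherianRing B] (hB : associatedPrimes B B ⊆ minimalPrimes B)
    (hirr : (nilradical B).IsPrime) {b : B} (hb : ¬ IsNilpotent b) : b ∈ nonZeroDivisors B := by
  have hb' : b ∉ ⋃ p ∈ associatedPrimes B B, (p : Set B) := by
    simp only [Set.mem_iUnion, not_exists]
    intro p hp hbp
    have hpm := hB hp
    have hpp : p.IsPrime := hpm.1.1
    have hle : nilradical B ≤ p := nilradical_le_prime p
    have := hpm.2 ⟨hirr, bot_le⟩ hle
    exact hb (this hbp)
  rw [biUnion_associatedPrimes_eq_compl_nonZeroDivisors] at hb'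
  simpa using hb'

theorem exists_smul_eq_zero_of_one_tmul_eq_zero {A B : Type*} [CommRing A] [IsDomain A]
    [CommRing B] [Algebra A B] {t : B} (ht : (1 : FractionRing A) ⊗ₜ[A] t = 0) :
    ∃ a : A, a ≠ 0 ∧ a • t = 0 := by
  obtain ⟨a, ha⟩ := (IsLocalizedModule.eq_zero_iff (nonZeroDivisors A)
    (TensorProduct.mk A (FractionRing A) B 1)).mp ht
  exact ⟨a, nonZeroDivisors.coe_ne_zero a, ha⟩

theorem exists_ne_zero_forall_one_tmul_ne_zero {A B : Type*} [CommRing A] [IsDomain A]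
    [IsNoetherianRing A] [CommRing B] [Algebra A B] [Algebra.FiniteType A B]
    (hB : associatedPrimes B B ⊆ minimalPrimes B) (hirr : (nilradical B).IsPrime)
    (hdom : ∀ a : A, IsNilpotent (algebraMap A B a) → a = 0) {t : B} (ht : t ≠ 0) :
    ∃ a : A, a ≠ 0 ∧ ∀ (F : Type*) [Field F] [Algebra A F], algebraMap A F a ≠ 0 →
      (1 : F) ⊗ₜ[A] t ≠ 0 := by
  have : IsNoetherianRing B := Algebra.FiniteType.isNoetherianRing A B
  have hK : (1 : FractionRing A) ⊗ₜ[A] t ≠ 0 := fun h => by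
    obtain ⟨a, ha, hat⟩ := exists_smul_eq_zero_of_one_tmul_eq_zero h
    have := mem_nonZeroDivisors_of_associatedPrimes_subset_minimalPrimes hB hirr
      (mt (hdom a) ha)
    rw [Algebra.smul_def] at hat
    exact ht (((mem_nonZeroDivisors_iff.mp this).1 t) hat)
  obtain ⟨a, ha, φ, hφ⟩ := exists_linearMap_localizationAway_eq_one hK
  exact ⟨a, ha, fun F _ _ haF => one_tmul_ne_zero_of_linearMap_localizationAway haF.isUnit φ hφ⟩

namespace AlgebraicGeometry

theorem IsAffineOpen.SpecMap_comp_fromSpec_appTop {X : Scheme} {U : X.Opens}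
    (hU : IsAffineOpen U) {R : CommRingCat} (φ : Γ(X, U) ⟶ R) :
    (Spec.map φ ≫ hU.fromSpec).appTop =
      X.presheaf.map (homOfLE le_top).op ≫ φ ≫ (Scheme.ΓSpecIso R).inv := by
  have hmap : (Spec Γ(X, U)).presheaf.map (homOfLE (le_top (a := ⊤))).op = 𝟙 _ :=
    (Spec Γ(X, U)).presheaf.map_id _
  have htop : hU.fromSpec.appTop = X.presheaf.map (homOfLE le_top).op ≫
      (Scheme.ΓSpecIso Γ(X, U)).inv := by
    refine (hU.fromSpec_app_of_le ⊤ le_top).trans ?_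
    exact congrArg (_ ≫ _ ≫ ·) hmap |>.trans (by rw [Category.comp_id])
  rw [Scheme.Hom.comp_appTop, htop, Category.assoc, Scheme.ΓSpecIso_inv_naturality]

theorem IsAffineOpen.SpecMap_evaluation_comp_fromSpec {S : Scheme} {V : S.Opens}
    (hV : IsAffineOpen V) {s : S} (hs : s ∈ V) :
    Spec.map (S.evaluation V s hs) ≫ hV.fromSpec = S.fromSpecResidueField s := by
  rw [Scheme.fromSpecResidueField, ← hV.fromSpecStalk_eq_fromSpecStalk hs,
    IsAffineOpen.fromSpecStalk, ← Spec.map_comp_assoc, Scheme.germ_residue]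

theorem map_eq_zero_of_fiber_appTop_eq_zero {X S : Scheme} (f : X ⟶ S) {V : S.Opens}
    {U : X.Opens} (hV : IsAffineOpen V) (hU : IsAffineOpen U) (e : U ≤ f ⁻¹ᵁ V) {s : S}
    (hs : s ∈ V) {t : Γ(X, ⊤)}
    (ht : (pullback.fst f (S.fromSpecResidueField s)).appTop t = 0) {R : CommRingCat}
    (φ : Γ(X, U) ⟶ R) (ψ : S.residueField s ⟶ R)
    (h : f.appLE V U e ≫ φ = S.evaluation V s hs ≫ ψ) :
    φ (X.presheaf.map (homOfLE le_top).op t) = 0 := by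
  have w : (Spec.map φ ≫ hU.fromSpec) ≫ f = Spec.map ψ ≫ S.fromSpecResidueField s := by
    rw [Category.assoc, ← IsAffineOpen.SpecMap_appLE_fromSpec f hV hU e, ← Spec.map_comp_assoc,
      h, Spec.map_comp_assoc, hV.SpecMap_evaluation_comp_fromSpec]
  have key : (Spec.map φ ≫ hU.fromSpec).appTop t = 0 := by
    rw [← pullback.lift_fst _ _ w, Scheme.Hom.comp_appTop, CommRingCat.comp_apply, ht, map_zero]
  rw [hU.SpecMap_comp_fromSpec_appTop] at key
  exact (map_eq_zero_iff _ (ConcreteCategory.bijective_of_isIso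
    (Scheme.ΓSpecIso R).inv).injective).mp key

theorem IsAffineOpen.isPrime_nilradical {X : Scheme} [IrreducibleSpace X] {U : X.Opens}
    (hU : IsAffineOpen U) [Nonempty U] : (nilradical Γ(X, U)).IsPrime := by
  have hnil (a : Γ(X, U)) : a ∈ nilradical Γ(X, U) ↔ X.basicOpen a = ⊥ :=
    mem_nilradical.trans (Scheme.isNilpotent_iff_basicOpen_eq_bot_of_isCompact hU.isCompact a)
  refine ⟨fun h => ?_, fun {a b} hab => ?_⟩
  · have : IsNilpotent (1 : Γ(X, U)) := (Ideal.eq_top_iff_one _).mp h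
    exact not_isNilpotent_one this
  · rw [hnil, Scheme.basicOpen_mul] at hab
    rw [hnil, hnil]
    by_contra! H
    obtain ⟨x, hx⟩ := nonempty_preirreducible_inter (X.basicOpen a).2 (X.basicOpen b).2
      ((TopologicalSpace.Opens.ne_bot_iff_nonempty _).mp H.1)
      ((TopologicalSpace.Opens.ne_bot_iff_nonempty _).mp H.2)
    have : x ∈ X.basicOpen a ⊓ X.basicOpen b := hx
    rw [hab] at this
    exact this

theorem eq_zero_of_isNilpotent_appLE {X S : Scheme} [IrreducibleSpace X] [IsReduced S]
    (f : X ⟶ S) [IsDominant f] {V : S.Opens} {U : X.Opens} [Nonempty U] (e : U ≤ f ⁻¹ᵁ V)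
    {a : Γ(S, V)} (ha : IsNilpotent (f.appLE V U e a)) : a = 0 := by
  by_contra h
  have hne : (S.basicOpen a : Set S).Nonempty := (TopologicalSpace.Opens.ne_bot_iff_nonempty _).mp
    (mt (basicOpen_eq_bot_iff a).mp h)
  obtain ⟨x, hx⟩ := f.denseRange.exists_mem_open (S.basicOpen a).2 hne
  obtain ⟨y, hy⟩ := nonempty_preirreducible_inter U.2 (f ⁻¹ᵁ S.basicOpen a).2
    (Set.nonempty_coe_sort.mp ‹_›) ⟨x, hx⟩
  have hbot : X.basicOpen (f.appLE V U e a) = ⊥ := X.basicOpen_eq_bot_of_isNilpotent U _ ha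
  rw [Scheme.basicOpen_appLE] at hbot
  have : y ∈ U ⊓ f ⁻¹ᵁ S.basicOpen a := hy
  rw [hbot] at this
  exact this

end AlgebraicGeometry

/-- Let `f : X ⟶ S` be a finite type dominant morphism of schemes, where `S`
is an integral noetherian scheme and `X` is an irreducible scheme with no embedded points.
Let `t ∈ Γ(X, O_X)` be a global section such that there is a dense set of points `s ∈ S` at
which the pullback of `t` to the fiber `X_s = X ×_S Spec κ(s)` vanishes. Then `t = 0`. -/
theorem global_section_eq_zero_of_vanishing_on_dense_set_of_fibers
    {X S : AlgebraicGeometry.Scheme} [IrreducibleSpace X]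
    (hX : X.NoEmbeddedPoints) [IsIntegral S] [IsNoetherian S]
    (f : X ⟶ S) [LocallyOfFiniteType f] [QuasiCompact f] [IsDominant f]
    (t : Γ(X, ⊤))
    (h : ∃ T : Set S, Dense T ∧ ∀ s ∈ T,
      (pullback.fst f (S.fromSpecResidueField s)).appTop t = 0) :
    t = 0 := by
  obtain ⟨T, hT, hTt⟩ := h
  have hloc (x : X) : ∃ U : X.Opens, x ∈ U ∧
      X.presheaf.map (homOfLE (le_top : U ≤ ⊤)).op t = 0 := by
    obtain ⟨V, hV, hxV, -⟩ := exists_isAffineOpen_mem_and_subset (x := f x) (U := ⊤) trivial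
    obtain ⟨U, hU, hxU, e⟩ := exists_isAffineOpen_mem_and_subset (x := x) (U := f ⁻¹ᵁ V) hxV
    refine ⟨U, hxU, ?_⟩
    by_contra hne
    have : Nonempty U := ⟨⟨x, hxU⟩⟩
    have : Nonempty V := ⟨⟨f x, hxV⟩⟩
    have : IsNoetherianRing Γ(S, V) := IsLocallyNoetherian.component_noetherian ⟨V, hV⟩
    algebraize [(f.appLE V U e).hom]
    have : Algebra.FiniteType Γ(S, V) Γ(X, U) := f.finiteType_appLE hV hU e
    obtain ⟨a, ha, haF⟩ := exists_ne_zero_forall_one_tmul_ne_zero (hX ⟨U, hU⟩)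
      hU.isPrime_nilradical (fun a => eq_zero_of_isNilpotent_appLE f e) hne
    obtain ⟨s, hsa, hsT⟩ := hT.inter_open_nonempty _ (S.basicOpen a).2
      ((TopologicalSpace.Opens.ne_bot_iff_nonempty _).mp (mt (basicOpen_eq_bot_iff a).mp ha))
    have hs : s ∈ V := S.basicOpen_le a hsa
    let : Algebra Γ(S, V) (IsLocalRing.ResidueField (S.presheaf.stalk s)) :=
      (S.evaluation V s hs).hom.toAlgebra
    refine haF (IsLocalRing.ResidueField (S.presheaf.stalk s))
      ((S.evaluation_ne_zero_iff_mem_basicOpen s hs a).mpr hsa) ?_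
    refine map_eq_zero_of_fiber_appTop_eq_zero f hV hU e hs (hTt s hsT)
      (R := .of (IsLocalRing.ResidueField (S.presheaf.stalk s) ⊗[Γ(S, V)] Γ(X, U)))
      (CommRingCat.ofHom Algebra.TensorProduct.includeRight.toRingHom)
      (CommRingCat.ofHom Algebra.TensorProduct.includeLeftRingHom) ?_
    ext c
    exact Algebra.TensorProduct.includeRight.commutes c
  choose U hxU hU using hloc
  refine X.sheaf.eq_of_locally_eq' U ⊤ (fun x => homOfLE le_top)
    (fun x _ => TopologicalSpace.Opens.mem_iSup.mpr ⟨x, hxU x⟩) t 0 fun x => ?_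
  exact (hU x).trans (map_zero _).symm
end

section
/- Let f : X → S be a finite type morphism of schemes, where S is an integral noetherian scheme with generic point η. Let t ∈ Γ(X, O_X) be a global section such that, for a dense set of points s ∈ S, the pullback of t to the fiber X_s is zero. Then the pullback of t to the generic fiber X_η is zero. -/
open AlgebraicGeometry CategoryTheory CategoryTheory.Limits

universe u

open scoped TensorProduct nonZeroDivisors

/-- A nonzero element of a Noetherian ring survives modulo a power of some maximal ideal. -/
lemma exists_isMaximal_notMem_pow {R : Type*} [CommRing R] [IsNoetherianRing R] {x : R}
    (hx : x ≠ 0) : ∃ m : Ideal R, m.IsMaximal ∧ ∃ n : ℕ, x ∉ m ^ n := by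
  have hne : Ideal.span {x} ≠ ⊥ := by simpa
  obtain ⟨m, hm, hle⟩ := Ideal.exists_le_maximal (Module.annihilator R (Ideal.span {x})) (by
    rw [Ne, Ideal.eq_top_iff_one, Module.mem_annihilator]
    intro h
    exact hx (by simpa using h ⟨x, Ideal.mem_span_singleton_self x⟩))
  refine ⟨m, hm, ?_⟩
  by_contra! hmem
  obtain ⟨r, hr⟩ := (m.mem_iInf_smul_pow_eq_bot_iff x).mp (by
    simpa [Submodule.mem_iInf] using hmem)
  refine hm.ne_top ((Ideal.eq_top_iff_one m).mpr ?_)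
  have h1 : 1 - (r : R) ∈ m := by
    refine hle (Module.mem_annihilator.mpr ?_)
    rintro ⟨y, hy⟩
    obtain ⟨z, rfl⟩ := Ideal.mem_span_singleton'.mp hy
    ext
    simp only [smul_eq_mul] at hr
    simp only [SetLike.mk_smul_mk, smul_eq_mul, ZeroMemClass.coe_zero]
    linear_combination -z * hr
  simpa using m.add_mem h1 r.2

/-- The quotient of a Noetherian ring by a power of a maximal ideal is Artinian. -/
lemma isArtinianRing_quotient_pow_of_isMaximal {R : Type*} [CommRing R] [IsNoetherianRing R]
    (m : Ideal R) [m.IsMaximal] (n : ℕ) : IsArtinianRing (R ⧸ m ^ n) := by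
  rw [isArtinianRing_iff_krullDimLE_zero]
  refine Ring.krullDimLE_zero_iff.mpr fun P hP => ?_
  have hle : m ≤ P.comap (Ideal.Quotient.mk (m ^ n)) := by
    refine Ideal.IsPrime.le_of_pow_le (n := n) ?_
    intro y hy
    simp [Ideal.mem_comap, Ideal.Quotient.eq_zero_iff_mem.mpr hy]
  have heq := Ideal.IsMaximal.eq_of_le ‹m.IsMaximal›
    (Ideal.IsPrime.comap (Ideal.Quotient.mk (m ^ n))).ne_top hle
  have : (P.comap (Ideal.Quotient.mk (m ^ n))).IsMaximal := heq ▸ ‹m.IsMaximal›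
  rw [← Ideal.map_comap_of_surjective _ Ideal.Quotient.mk_surjective P]
  exact (Ideal.map_eq_top_or_isMaximal_of_surjective _ Ideal.Quotient.mk_surjective
    this).resolve_left (by
      rw [Ideal.map_comap_of_surjective _ Ideal.Quotient.mk_surjective]; exact hP.ne_top)

/-- A nonzero element of a finite type algebra over a field acts nontrivially in some
finite-dimensional matrix representation. -/
lemma exists_algHom_matrix_apply_ne_zero {K R : Type*} [Field K] [CommRing R] [Algebra K R]
    [Algebra.FiniteType K R] {x : R} (hx : x ≠ 0) :
    ∃ (n : ℕ) (ρ : R →ₐ[K] Matrix (Fin n) (Fin n) K), ρ x ≠ 0 := by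
  have : IsNoetherianRing R := Algebra.FiniteType.isNoetherianRing K R
  obtain ⟨m, hm, n, hn⟩ := exists_isMaximal_notMem_pow hx
  have := isArtinianRing_quotient_pow_of_isMaximal m n
  have : Module.Finite K (R ⧸ m ^ n) := Module.finite_of_isArtinianRing K _
  refine ⟨_, (Algebra.leftMulMatrix (Module.finBasis K (R ⧸ m ^ n))).comp
    (Ideal.Quotient.mkₐ K (m ^ n)), fun h => hn ?_⟩
  rw [AlgHom.comp_apply, map_eq_zero_iff _ (Algebra.leftMulMatrix_injective _)] at h
  exact Ideal.Quotient.eq_zero_iff_mem.mp h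

/-- If an element `b` of a finite type algebra over a domain `A` is not torsion, then it is
nonzero after base change to any nontrivial `A`-algebra in which a suitable nonzero `c : A`
is invertible. -/
lemma exists_ne_zero_forall_tmul_ne_zero {A B : Type*} [CommRing A] [IsDomain A] [CommRing B]
    [Algebra A B] [Algebra.FiniteType A B] {b : B} (hb : ∀ a : A, a ≠ 0 → a • b ≠ 0) :
    ∃ c : A, c ≠ 0 ∧ ∀ (k : Type*) [CommRing k] [Nontrivial k] [Algebra A k],
      IsUnit (algebraMap A k c) → (1 : k) ⊗ₜ[A] b ≠ 0 := by
  classical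
  let K := FractionRing A
  have hbK : (1 : K) ⊗ₜ[A] b ≠ 0 := by
    intro h
    obtain ⟨a, ha⟩ := (IsLocalizedModule.eq_zero_iff A⁰ (TensorProduct.mk A K B 1)).mp h
    exact hb a (nonZeroDivisors.ne_zero a.2) ha
  obtain ⟨n, ρK, hρK⟩ := exists_algHom_matrix_apply_ne_zero (K := K) hbK
  let ρ : B →ₐ[A] Matrix (Fin n) (Fin n) K :=
    (ρK.restrictScalars A).comp Algebra.TensorProduct.includeRight
  obtain ⟨i, j, hij⟩ : ∃ i j, ρ b i j ≠ 0 := by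
    by_contra! h
    exact hρK (Matrix.ext h)
  obtain ⟨s, hs⟩ := Algebra.FiniteType.out (R := A) (A := B)
  let D : Finset K := insert (ρ b i j)⁻¹
    (s.biUnion fun x => Finset.univ.image fun p : Fin n × Fin n => ρ x p.1 p.2)
  obtain ⟨⟨c, hc⟩, hcD⟩ := IsLocalization.exist_integer_multiples_of_finset A⁰ D
  have hc0 : c ≠ 0 := nonZeroDivisors.ne_zero hc
  refine ⟨c, hc0, ?_⟩
  have hcK : algebraMap A K c ≠ 0 := by simpa using hc0
  let incl : Localization.Away c →ₐ[A] K :=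
    IsLocalization.liftAlgHom (M := Submonoid.powers c) (f := Algebra.ofId A K) (by
      rintro ⟨_, l, rfl⟩
      simpa only [Algebra.ofId_apply, map_pow] using (IsUnit.mk0 _ hcK).pow l)
  have hincl : Function.Injective incl := by
    refine (injective_iff_map_eq_zero incl).mpr fun z hz => ?_
    obtain ⟨⟨a, d⟩, had⟩ := IsLocalization.surj (Submonoid.powers c) z
    have ha : a = 0 := by
      simpa [hz] using (congrArg incl had).symm
    rw [ha, map_zero] at had
    exact (IsLocalization.map_units _ d).mul_left_eq_zero.mp had
  have hD : ∀ z ∈ D, ∃ w, incl w = z := by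
    intro z hz
    obtain ⟨a, ha⟩ := hcD z hz
    refine ⟨IsLocalization.mk' _ a (⟨c, Submonoid.mem_powers c⟩ : Submonoid.powers c), ?_⟩
    apply mul_left_cancel₀ hcK
    rw [← Algebra.smul_def c z, ← ha, ← incl.commutes, ← map_mul,
      IsLocalization.mk'_spec'_mk, incl.commutes]
  have hinclM : Function.Injective (incl.mapMatrix (m := Fin n)) := Matrix.map_injective hincl
  have hρ : ∀ x, ρ x ∈ (incl.mapMatrix (m := Fin n)).range := by
    intro x
    suffices h : Algebra.adjoin A (s : Set B) ≤ (incl.mapMatrix (m := Fin n)).range.comap ρ from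
      h (hs ▸ Algebra.mem_top)
    refine Algebra.adjoin_le fun y hy => ?_
    choose w hw using fun p : Fin n × Fin n => hD (ρ y p.1 p.2) (by
      refine Finset.mem_insert_of_mem (Finset.mem_biUnion.mpr ⟨y, hy, ?_⟩)
      exact Finset.mem_image.mpr ⟨p, Finset.mem_univ _, rfl⟩)
    exact ⟨Matrix.of fun i j => w (i, j), Matrix.ext fun i j => hw (i, j)⟩
  let ρ' : B →ₐ[A] Matrix (Fin n) (Fin n) (Localization.Away c) :=
    ((AlgEquiv.ofInjective _ hinclM).symm : _ →ₐ[A] _).comp (ρ.codRestrict _ hρ)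
  have hρ' : ∀ x i j, incl (ρ' x i j) = ρ x i j := by
    intro x i j
    have : incl.mapMatrix (ρ' x) = ρ x :=
      congrArg Subtype.val ((AlgEquiv.ofInjective _ hinclM).apply_symm_apply (ρ.codRestrict _ hρ x))
    exact congrFun (congrFun this i) j
  have hunit : IsUnit (ρ' b i j) := by
    obtain ⟨w, hw⟩ := hD _ (Finset.mem_insert_self _ _)
    refine IsUnit.of_mul_eq_one w (hincl ?_)
    rw [map_mul, hρ', hw, map_one, mul_inv_cancel₀ hij]
  intro k _ _ _ hck h
  let φ : Localization.Away c →ₐ[A] k :=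
    IsLocalization.liftAlgHom (M := Submonoid.powers c) (f := Algebra.ofId A k) (by
      rintro ⟨_, l, rfl⟩
      simpa [Algebra.ofId_apply] using hck.pow l)
  let ψ : k ⊗[A] B →ₐ[k] Matrix (Fin n) (Fin n) k :=
    Algebra.TensorProduct.lift (Algebra.ofId k _) (φ.mapMatrix.comp ρ')
      fun x y => Algebra.commutes x _
  have hψ : ψ (1 ⊗ₜ[A] b) = φ.mapMatrix (ρ' b) :=
    (Algebra.TensorProduct.lift_tmul ..).trans (by rw [map_one, one_mul]; rfl)
  rw [h, map_zero] at hψ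
  exact (hunit.map φ).ne_zero (congrFun (congrFun hψ i) j).symm

/-- If `b` is not torsion over the domain `A`, where `f : A →+* B` is of finite type, then `b`
has nonzero image in some common extension of `B` and any `A`-algebra in which a suitable
nonzero `c : A` is invertible. -/
lemma exists_ne_zero_forall_exists_comp_eq {A B : Type u} [CommRing A] [IsDomain A] [CommRing B]
    {f : A →+* B} (hf : f.FiniteType) {b : B} (hb : ∀ a : A, a ≠ 0 → f a * b ≠ 0) :
    ∃ c : A, c ≠ 0 ∧ ∀ (k : Type u) [CommRing k] [Nontrivial k] (g : A →+* k), IsUnit (g c) →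
      ∃ (C : Type u) (_ : CommRing C) (p : B →+* C) (q : k →+* C),
        p.comp f = q.comp g ∧ p b ≠ 0 := by
  algebraize [f]
  obtain ⟨c, hc, H⟩ := exists_ne_zero_forall_tmul_ne_zero (A := A) (b := b)
    fun a ha => by rw [Algebra.smul_def]; exact hb a ha
  refine ⟨c, hc, fun k _ _ g hg => ?_⟩
  let := g.toAlgebra
  refine ⟨k ⊗[A] B, inferInstance, Algebra.TensorProduct.includeRight.toRingHom,
    Algebra.TensorProduct.includeLeftRingHom, ?_, H k hg⟩
  ext a
  exact (Algebra.TensorProduct.tmul_one_eq_one_tmul a).symm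

/-- If a section vanishes on the fiber over `s`, then its restriction to an affine open `U` dies
in every ring receiving compatible maps from `Γ(X, U)` and from the residue field at `s`. -/
lemma apply_map_eq_zero_of_fiber_eq_zero {X S : Scheme.{u}} (f : X ⟶ S) {V : S.Opens}
    (hV : IsAffineOpen V) {U : X.Opens} (hU : IsAffineOpen U) (e : U ≤ f ⁻¹ᵁ V) (t : Γ(X, ⊤))
    {s : S} (hs : s ∈ V) (ht : (pullback.fst f (S.fromSpecResidueField s)).appTop t = 0)
    {C : CommRingCat.{u}} (p : Γ(X, U) ⟶ C) (q : S.residueField s ⟶ C)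
    (hpq : f.appLE V U e ≫ p = (S.presheaf.germ V s hs ≫ S.residue s) ≫ q) :
    p (X.presheaf.map (homOfLE le_top).op t) = 0 := by
  have hsq : (Spec.map p ≫ hU.fromSpec) ≫ f = Spec.map q ≫ S.fromSpecResidueField s := by
    rw [Category.assoc, ← IsAffineOpen.SpecMap_appLE_fromSpec f hV hU e, ← Spec.map_comp_assoc,
      hpq, Scheme.fromSpecResidueField, ← hV.fromSpecStalk_eq_fromSpecStalk hs,
      IsAffineOpen.fromSpecStalk]
    simp only [Spec.map_comp, Category.assoc]
  have h0 : (Spec.map p ≫ hU.fromSpec).appTop t = 0 := by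
    rw [← pullback.lift_fst _ _ hsq, Scheme.Hom.comp_appTop, CommRingCat.comp_apply, ht, map_zero]
  have h1 : (Spec.map p ≫ hU.fromSpec).appTop ≫ (Scheme.ΓSpecIso C).hom =
      X.presheaf.map (homOfLE le_top).op ≫ p := by
    have h2 : hU.fromSpec.appTop = X.presheaf.map (homOfLE le_top).op ≫
        (Scheme.ΓSpecIso Γ(X, U)).inv := by
      refine (hU.fromSpec_app_of_le ⊤ le_top).trans (congrArg (_ ≫ ·) ?_)
      exact (congrArg (_ ≫ ·) ((Spec Γ(X, U)).presheaf.map_id _)).trans (Category.comp_id _)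
    rw [Scheme.Hom.comp_appTop, h2]
    simp
  have h3 := ConcreteCategory.congr_hom h1 t
  rw [CommRingCat.comp_apply, h0, map_zero] at h3
  exact h3.symm

/-- A nonzero function on an open subset of an integral scheme is invertible after pulling back
along a morphism that factors set-theoretically through the generic point. -/
lemma isUnit_appLE_of_forall_eq_genericPoint {Z S : Scheme.{u}} [IsIntegral S] (h : Z ⟶ S)
    (hh : ∀ z, h z = genericPoint S) {V : S.Opens} {W : Z.Opens} (e : W ≤ h ⁻¹ᵁ V)
    {a : Γ(S, V)} (ha : a ≠ 0) : IsUnit (h.appLE V W e a) := by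
  have hη : genericPoint S ∈ S.basicOpen a := by
    have hne : S.basicOpen a ≠ ⊥ := by rwa [Ne, basicOpen_eq_bot_iff]
    obtain ⟨x, hx⟩ := (TopologicalSpace.Opens.ne_bot_iff_nonempty _).mp hne
    exact ((genericPoint_spec S).mem_open_set_iff (S.basicOpen a).2).mpr ⟨x, trivial, hx⟩
  refine RingedSpace.isUnit_of_isUnit_germ (X := Z.toSheafedSpace) _ _ fun z hz => ?_
  rw [← Scheme.mem_basicOpen _ _ _ hz, Scheme.basicOpen_appLE]
  exact ⟨hz, show h z ∈ S.basicOpen a from (hh z).symm ▸ hη⟩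

/-- Let `f : X ⟶ S` be a finite type morphism of schemes, where `S` is an
integral noetherian scheme with generic point `η`. Let `t ∈ Γ(X, O_X)` be a global section
such that there is a dense set of points `s ∈ S` at which the pullback of `t` to the fiber
`X_s = X ×_S Spec κ(s)` vanishes. Then the pullback of `t` to the generic fiber `X_η`
vanishes. -/
theorem pullback_section_to_generic_fiber_eq_zero_of_vanishing_on_dense_set_of_fibers
    {X S : AlgebraicGeometry.Scheme} [IsIntegral S] [IsNoetherian S]
    (f : X ⟶ S) [LocallyOfFiniteType f] [QuasiCompact f]
    (t : Γ(X, ⊤))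
    (h : ∃ T : Set S, Dense T ∧ ∀ s ∈ T,
      (pullback.fst f (S.fromSpecResidueField s)).appTop t = 0) :
    (pullback.fst f (S.fromSpecResidueField (genericPoint S))).appTop t = 0 := by
  obtain ⟨T, hT, hTt⟩ := h
  obtain ⟨V, hV, hηV, -⟩ := TopologicalSpace.Opens.isBasis_iff_nbhd.mp S.isBasis_affineOpens
    (show genericPoint S ∈ (⊤ : S.Opens) from trivial)
  have : Nonempty V := ⟨⟨_, hηV⟩⟩
  let g := pullback.fst f (S.fromSpecResidueField (genericPoint S))
  have hg : ∀ z, (g ≫ f) z = genericPoint S := by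
    intro z
    rw [pullback.condition, Scheme.Hom.comp_apply]
    have := Set.mem_range_self (f := S.fromSpecResidueField (genericPoint S))
      (pullback.snd f (S.fromSpecResidueField (genericPoint S)) z)
    rwa [Scheme.range_fromSpecResidueField] at this
  refine TopCat.Sheaf.eq_of_locally_eq'
    (pullback f (S.fromSpecResidueField (genericPoint S))).sheaf
    (fun U : {U : X.Opens // IsAffineOpen U ∧ U ≤ f ⁻¹ᵁ V} => g ⁻¹ᵁ U.1) ⊤
    (fun U => homOfLE le_top) ?_ _ _ ?_
  · intro z _
    have hz : g z ∈ f ⁻¹ᵁ V := by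
      change f (g z) ∈ V
      rw [← Scheme.Hom.comp_apply, hg]
      exact hηV
    obtain ⟨U, hU, hzU, hle⟩ := TopologicalSpace.Opens.isBasis_iff_nbhd.mp
      X.isBasis_affineOpens hz
    exact TopologicalSpace.Opens.mem_iSup.mpr ⟨⟨U, hU, hle⟩, hzU⟩
  rintro ⟨U, hU, e⟩
  obtain ⟨a, ha, hat⟩ : ∃ a : Γ(S, V), a ≠ 0 ∧
      f.appLE V U e a * X.presheaf.map (homOfLE le_top).op t = 0 := by
    by_contra! hb
    obtain ⟨c, hc, H⟩ := exists_ne_zero_forall_exists_comp_eq (f.finiteType_appLE hV hU e) hb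
    have hne : S.basicOpen c ≠ ⊥ := by rwa [Ne, basicOpen_eq_bot_iff]
    obtain ⟨s, hsc, hsT⟩ := hT.inter_open_nonempty _ (S.basicOpen c).2
      ((TopologicalSpace.Opens.ne_bot_iff_nonempty _).mp hne)
    have hsV : s ∈ V := S.basicOpen_le c hsc
    obtain ⟨C, _, p, q, hpq, hp⟩ := H (S.residueField s)
      (S.presheaf.germ V s hsV ≫ S.residue s).hom
      (((Scheme.mem_basicOpen _ _ _ hsV).mp hsc).map (S.residue s).hom)
    exact hp (apply_map_eq_zero_of_fiber_eq_zero f hV hU e t hsV (hTt s hsT)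
      (CommRingCat.ofHom p) (CommRingCat.ofHom q) (CommRingCat.hom_ext hpq))
  have hunit : IsUnit (g.app U (f.appLE V U e a)) := by
    have := isUnit_appLE_of_forall_eq_genericPoint (g ≫ f) hg
      (W := g ⁻¹ᵁ U) (fun z hz => e hz) ha
    rwa [← Scheme.Hom.appLE_comp_appLE (U := V) (V := U) (W := g ⁻¹ᵁ U) g f e le_rfl,
      CommRingCat.comp_apply, ← Scheme.Hom.app_eq_appLE] at this
  have hgt : g.app U (X.presheaf.map (homOfLE le_top).op t) = 0 := by
    rw [← hunit.mul_right_eq_zero, ← map_mul, hat, map_zero]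
  have hnat := ConcreteCategory.congr_hom (g.naturality (homOfLE (le_top : U ≤ ⊤)).op) t
  exact hnat.symm.trans (hgt.trans (map_zero _).symm)
end

section
/- Let f : X → S be a dominant morphism of noetherian schemes, where S is integral with generic point η and X is irreducible with no embedded points. Let t ∈ Γ(X, O_X) be a global section whose pullback to the generic fiber X_η is zero. Then t = 0. -/
open AlgebraicGeometry CategoryTheory CategoryTheory.Limits

namespace AlgebraicGeometry

universe u

/-- In an affine open of an irreducible scheme, the generic point corresponds to the smallest
prime ideal. -/
lemma IsAffineOpen.primeIdealOf_genericPoint_le {X : Scheme.{u}} [IrreducibleSpace X]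
    {U : X.Opens} (hU : IsAffineOpen U) (hξ : genericPoint X ∈ U)
    (p : PrimeSpectrum Γ(X, U)) :
    hU.primeIdealOf ⟨genericPoint X, hξ⟩ ≤ p := by
  rw [PrimeSpectrum.le_iff_specializes]
  refine hU.fromSpec.isOpenEmbedding.isInducing.specializes_iff.mp ?_
  rw [hU.fromSpec_primeIdealOf]
  exact genericPoint_specializes _

/-- On an irreducible locally noetherian scheme without embedded points, sections over an affine
open are determined by their germ at the generic point. -/
lemma Scheme.NoEmbeddedPoints.germ_genericPoint_injective {X : Scheme.{u}}
    [IsLocallyNoetherian X] [IrreducibleSpace X] (hX : X.NoEmbeddedPoints)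
    {U : X.Opens} (hU : IsAffineOpen U) (hξ : genericPoint X ∈ U) :
    Function.Injective (X.presheaf.germ U (genericPoint X) hξ) := by
  rw [injective_iff_map_eq_zero]
  intro s hs
  by_contra hs0
  have : IsNoetherianRing Γ(X, U) := IsLocallyNoetherian.component_noetherian ⟨U, hU⟩
  let := X.presheaf.algebra_section_stalk ⟨genericPoint X, hξ⟩
  have := hU.isLocalization_stalk ⟨genericPoint X, hξ⟩
  obtain ⟨⟨r, hr⟩, hrs⟩ := (IsLocalization.map_eq_zero_iff
    (hU.primeIdealOf ⟨genericPoint X, hξ⟩).asIdeal.primeCompl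
    (X.presheaf.stalk (genericPoint X)) s).mp hs
  have hmem : r ∈ ⋃ p ∈ associatedPrimes Γ(X, U) Γ(X, U), (p : Set Γ(X, U)) := by
    rw [biUnion_associatedPrimes_eq_zero_divisors]
    exact ⟨s, hs0, hrs⟩
  simp only [Set.mem_iUnion, SetLike.mem_coe] at hmem
  obtain ⟨p, hp, hrp⟩ := hmem
  exact hr <| (hX ⟨U, hU⟩ p hp).2
    ⟨(hU.primeIdealOf ⟨genericPoint X, hξ⟩).isPrime, bot_le⟩
    (hU.primeIdealOf_genericPoint_le hξ ⟨p, hp.isPrime⟩) hrp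

/-- On an irreducible locally noetherian scheme without embedded points, a global section whose
germ at the generic point vanishes is zero. -/
lemma Scheme.NoEmbeddedPoints.eq_zero_of_germ_genericPoint_eq_zero {X : Scheme.{u}}
    [IsLocallyNoetherian X] [IrreducibleSpace X] (hX : X.NoEmbeddedPoints) {t : Γ(X, ⊤)}
    (ht : X.presheaf.germ ⊤ (genericPoint X) trivial t = 0) : t = 0 := by
  refine X.IsSheaf.section_ext fun x _ ↦ ?_
  obtain ⟨_, ⟨U, hU, rfl⟩, hxU, -⟩ :=
    X.isBasis_affineOpens.exists_subset_of_mem_open (Set.mem_univ x) isOpen_univ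
  have hξ : genericPoint X ∈ U := (genericPoint_specializes x).mem_open U.2 hxU
  refine ⟨U, le_top, hxU, hX.germ_genericPoint_injective hU hξ ?_⟩
  rw [TopCat.Presheaf.germ_res_apply', TopCat.Presheaf.germ_res_apply', ht, map_zero]

/-- A dominant morphism of irreducible schemes maps the generic point to the generic point. -/
lemma Scheme.Hom.apply_genericPoint {X S : Scheme.{u}} [IrreducibleSpace X] [IrreducibleSpace S]
    (f : X ⟶ S) [IsDominant f] : f (genericPoint X) = genericPoint S := by
  refine ((genericPoint_spec X).image f.continuous).eq ?_
  rw [Set.image_univ, f.denseRange.closure_range]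
  exact genericPoint_spec S

lemma Scheme.isIso_residue_of_isField {S : Scheme.{u}} (s : S)
    (hs : IsField (S.presheaf.stalk s)) : IsIso (S.residue s) := by
  let := hs.toField
  exact (ConcreteCategory.isIso_iff_bijective _).mpr
    ⟨(S.residue s).hom.injective, S.residue_surjective s⟩

/-- If the local ring of `S` at `f x` is a field, then a global section vanishing on the fiber of
`f` through `x` has zero germ at `x`. -/
lemma Scheme.germ_eq_zero_of_fiber_eq_zero {X S : Scheme.{u}} (f : X ⟶ S) (x : X) {s : S}
    (hx : f x = s) (hs : IsField (S.presheaf.stalk s)) {t : Γ(X, ⊤)}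
    (ht : (pullback.fst f (S.fromSpecResidueField s)).appTop t = 0) :
    X.presheaf.germ ⊤ x trivial t = 0 := by
  subst hx
  have := isIso_residue_of_isField _ hs
  let g : Spec (X.presheaf.stalk x) ⟶ pullback f (S.fromSpecResidueField (f x)) :=
    pullback.lift (X.fromSpecStalk x)
      (Spec.map (f.stalkMap x) ≫ inv (Spec.map (S.residue (f x)))) (by
        simp [fromSpecResidueField, SpecMap_stalkMap_fromSpecStalk])
  have hg : g ≫ pullback.fst f (S.fromSpecResidueField (f x)) = X.fromSpecStalk x :=
    pullback.lift_fst ..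
  have h : (X.fromSpecStalk x).appTop t = 0 := by
    rw [← hg, Scheme.Hom.comp_appTop, CommRingCat.comp_apply, ht, map_zero]
  have hgerm : X.presheaf.germ ⊤ x trivial =
      (X.fromSpecStalk x).appTop ≫ (ΓSpecIso (X.presheaf.stalk x)).hom := by
    simp [fromSpecStalk_appTop]
  rw [hgerm, CommRingCat.comp_apply, h, map_zero]

end AlgebraicGeometry

/-- Let `f : X ⟶ S` be a dominant morphism of noetherian schemes, where `S`
is integral with generic point `η` and `X` is irreducible with no embedded points. Let
`t ∈ Γ(X, O_X)` be a global section whose pullback to the generic fiber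
`X_η = X ×_S Spec κ(η)` is zero. Then `t = 0`. -/
theorem global_section_eq_zero_of_vanishing_on_generic_fiber
    {X S : AlgebraicGeometry.Scheme} [IsNoetherian X] [IsNoetherian S]
    [IsIntegral S] [IrreducibleSpace X] (hX : X.NoEmbeddedPoints)
    (f : X ⟶ S) [IsDominant f]
    (t : Γ(X, ⊤))
    (h : (pullback.fst f (S.fromSpecResidueField (genericPoint S))).appTop t = 0) :
    t = 0 :=
  hX.eq_zero_of_germ_genericPoint_eq_zero <|
    Scheme.germ_eq_zero_of_fiber_eq_zero f _ f.apply_genericPoint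
      (Field.toIsField S.functionField) h
end

section
/- Let A ⊆ B be an inclusion of commutative noetherian rings. Assume that A is an integral domain, that B has a unique minimal prime ideal, and that B has no embedded primes. Then the localization map B → (A ∖ {0})⁻¹ B, inverting the (images of the) nonzero elements of A, is injective. -/
/-- If `B` has a unique minimal prime, every element of a minimal prime is nilpotent. -/
theorem isNilpotent_of_mem_of_existsUnique_minimalPrimes {B : Type*} [CommRing B]
    (hmin : ∃! P : Ideal B, P ∈ minimalPrimes B) {P : Ideal B} (hP : P ∈ minimalPrimes B)
    {x : B} (hx : x ∈ P) : IsNilpotent x := by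
  rw [← mem_nilradical, nilradical, Ideal.zero_eq_bot, ← Ideal.sInf_minimalPrimes, Ideal.mem_sInf]
  intro Q hQ
  rwa [hmin.unique hQ hP]


/-- Let `A ⊆ B` be an inclusion of commutative noetherian rings. Assume that
`A` is an integral domain, that `B` has a unique minimal prime ideal, and that `B` has no
embedded primes. Then the localization map `B → (A ∖ {0})⁻¹ B`, inverting the images of the
nonzero elements of `A` (i.e. the nonzerodivisors of the domain `A`), is injective. -/
theorem injective_localizationMap_of_uniqueMinimalPrime_of_noEmbeddedPrimes
    {A B : Type*} [CommRing A] [CommRing B] [IsNoetherianRing A] [IsNoetherianRing B]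
    [IsDomain A] [Algebra A B] (hinj : Function.Injective (algebraMap A B))
    (hmin : ∃! P : Ideal B, P ∈ minimalPrimes B)
    (hemb : ∀ P ∈ associatedPrimes B B, P ∈ minimalPrimes B) :
    Function.Injective
      (algebraMap B (Localization (Algebra.algebraMapSubmonoid B (nonZeroDivisors A)))) := by
  refine IsLocalization.injective _ (M := Algebra.algebraMapSubmonoid B (nonZeroDivisors A)) ?_
  rintro _ ⟨a, ha, rfl⟩
  by_contra hzero
  rw [← SetLike.mem_coe, ← Set.mem_compl_iff,
    ← biUnion_associatedPrimes_eq_compl_nonZeroDivisors] at hzero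
  obtain ⟨P, hP, haP⟩ := Set.mem_iUnion₂.mp hzero
  have hnil := isNilpotent_of_mem_of_existsUnique_minimalPrimes hmin (hemb P hP) haP
  exact nonZeroDivisors.ne_zero ha ((IsNilpotent.map_iff hinj).mp hnil).eq_zero
end

section
/- Let A be a commutative ring, let M be a free A-module, and let (I_i)_{i ∈ J} be a (possibly infinite) family of ideals of A. Then the intersection of the submodules I_i • M equals the submodule (⋂_{i ∈ J} I_i) • M. In particular, if (p_i)_{i ∈ J} is a family of ideals with ⋂_{i ∈ J} p_i = 0, then ⋂_{i ∈ J} (p_i • M) = 0. -/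
/-- An element lies in `I • ⊤` if and only if all its coordinates in a given basis lie in `I`. -/
theorem Module.Basis.mem_ideal_smul_top_iff_repr_mem {A M ι : Type*} [CommRing A]
    [AddCommGroup M] [Module A M] (b : Module.Basis ι A M) (I : Ideal A) (x : M) :
    x ∈ I • (⊤ : Submodule A M) ↔ ∀ k, b.repr x k ∈ I := by
  rw [← b.span_eq, Submodule.mem_ideal_smul_span_iff_exists_sum]
  constructor
  · rintro ⟨a, ha, rfl⟩ k
    rw [← Finsupp.linearCombination_apply, b.repr_linearCombination]
    exact ha k
  · intro h
    exact ⟨b.repr x, h, b.linearCombination_repr x⟩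

theorem Submodule.iInf_ideal_smul_top_of_free {A M J : Type*} [CommRing A]
    [AddCommGroup M] [Module A M] [Module.Free A M] (I : J → Ideal A) :
    (⨅ i, I i • (⊤ : Submodule A M)) = (⨅ i, I i) • (⊤ : Submodule A M) := by
  ext x
  simp only [Submodule.mem_iInf,
    (Module.Free.chooseBasis A M).mem_ideal_smul_top_iff_repr_mem]
  exact forall_comm


/-- Let `A` be a commutative ring, `M` a free `A`-module, and `(I i)` a
(possibly infinite) family of ideals of `A`. Then `⋂ᵢ (Iᵢ • M) = (⋂ᵢ Iᵢ) • M`. In particular,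
if `(p i)` is a family of ideals with `⋂ᵢ pᵢ = 0`, then `⋂ᵢ (pᵢ • M) = 0`. -/
theorem iInf_ideal_smul_eq_iInf_smul_of_free
    {A : Type*} [CommRing A] {M : Type*} [AddCommGroup M] [Module A M]
    (hM : Module.Free A M) {J : Type*} (I : J → Ideal A) :
    (⨅ i, I i • (⊤ : Submodule A M)) = (⨅ i, I i) • (⊤ : Submodule A M) ∧
      ∀ p : J → Ideal A, (⨅ i, p i) = ⊥ → (⨅ i, p i • (⊤ : Submodule A M)) = ⊥ := by
  refine ⟨Submodule.iInf_ideal_smul_top_of_free I, fun p hp => ?_⟩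
  rw [Submodule.iInf_ideal_smul_top_of_free, hp, Submodule.bot_smul]
end

section
/- Let A be a noetherian integral domain with fraction field K, let B be a finite type A-algebra, let M be a finitely generated B-module (viewed also as an A-module via the structure map), and let m ∈ M. Suppose there is a set S of prime ideals of A with ⋂_{p ∈ S} p = 0 such that, for every p ∈ S, the image of m under the natural map M → M ⊗_A κ(p) is zero, where κ(p) is the fraction field of A/p. Then the image of m under the natural map M → M ⊗_A K is zero. -/
open TensorProduct

/-- Over an algebra of finite type over a field, every nonzero element of a finitely generated
module survives in some quotient module that is finite-dimensional over the field. -/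
theorem exists_notMem_and_finite_quotient_of_ne_zero {K C N : Type*} [Field K] [CommRing C]
    [Algebra K C] [Algebra.FiniteType K C] [AddCommGroup N] [Module C N] [Module K N]
    [IsScalarTower K C N] [Module.Finite C N] {x : N} (hx : x ≠ 0) :
    ∃ Q : Submodule C N, x ∉ Q ∧ Module.Finite K (N ⧸ Q) := by
  have : IsNoetherianRing C := Algebra.FiniteType.isNoetherianRing K C
  obtain ⟨n, hn, hxn⟩ := Ideal.exists_le_maximal (Ideal.torsionOf C N x)
    (by rwa [Ne, Ideal.torsionOf_eq_top_iff])
  have hxk : x ∉ (⨅ i : ℕ, n ^ i • ⊤ : Submodule C N) := by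
    rw [Ideal.mem_iInf_smul_pow_eq_bot_iff]
    rintro ⟨r, hr⟩
    refine hn.ne_top ((Ideal.eq_top_iff_one n).mpr ?_)
    have : 1 - (r : C) ∈ n := hxn (by simp [Ideal.mem_torsionOf_iff, sub_smul, hr])
    simpa using n.add_mem this r.2
  obtain ⟨k, hk⟩ : ∃ k : ℕ, x ∉ (n ^ k • ⊤ : Submodule C N) := by
    simpa [Submodule.mem_iInf] using hxk
  refine ⟨n ^ k • ⊤, hk, ?_⟩
  have : Ring.KrullDimLE 0 (C ⧸ n ^ k) := by
    refine Ring.KrullDimLE.mk₀ fun P hP => ?_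
    have hle : n ≤ P.comap (Ideal.Quotient.mk (n ^ k)) := by
      refine Ideal.IsPrime.le_of_pow_le (n := k) fun y hy => ?_
      simp [Ideal.mem_comap, Ideal.Quotient.eq_zero_iff_mem.mpr hy]
    have hmax : (P.comap (Ideal.Quotient.mk (n ^ k))).IsMaximal :=
      hn.eq_of_le (Ideal.IsPrime.ne_top inferInstance) hle ▸ hn
    rw [← Ideal.map_comap_of_surjective _ Ideal.Quotient.mk_surjective P]
    refine (Ideal.map_eq_top_or_isMaximal_of_surjective _ Ideal.Quotient.mk_surjective
      hmax).resolve_left ?_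
    rw [Ideal.map_comap_of_surjective _ Ideal.Quotient.mk_surjective]
    exact hP.ne_top
  have : IsArtinianRing (C ⧸ n ^ k) := isArtinianRing_iff_krullDimLE_zero.mpr this
  have : Module.Finite K (C ⧸ n ^ k) := (Module.finite_iff_isArtinianRing K _).mpr this
  have : Module.Finite (C ⧸ n ^ k) (N ⧸ (n ^ k • ⊤ : Submodule C N)) :=
    Module.Finite.of_restrictScalars_finite C _ _
  have : IsScalarTower K (C ⧸ n ^ k) (N ⧸ (n ^ k • ⊤ : Submodule C N)) := by
    refine ⟨fun a c y => ?_⟩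
    obtain ⟨c, rfl⟩ := Ideal.Quotient.mk_surjective c
    obtain ⟨y, rfl⟩ := Submodule.Quotient.mk_surjective _ y
    change Submodule.Quotient.mk ((a • c) • y) = a • Submodule.Quotient.mk (c • y)
    rw [smul_assoc, Submodule.Quotient.mk_smul]
  exact Module.Finite.trans (C ⧸ n ^ k) _

/-- Finitely many elements of the fraction field of a domain have a common denominator. -/
theorem exists_ne_zero_and_subset_ofField_powers {A : Type*} [CommRing A] [IsDomain A]
    (K : Type*) [Field K] [Algebra A K] [IsFractionRing A K] {F : Set K} (hF : F.Finite) :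
    ∃ (a : A) (ha : a ≠ 0),
      F ⊆ Localization.subalgebra.ofField K (Submonoid.powers a)
        (powers_le_nonZeroDivisors_of_noZeroDivisors ha) := by
  obtain ⟨⟨a, ha⟩, h⟩ :=
    IsLocalization.exist_integer_multiples_of_finset (nonZeroDivisors A) hF.toFinset
  have ha0 := nonZeroDivisors.ne_zero ha
  refine ⟨a, ha0, fun x hx => ?_⟩
  obtain ⟨c, hc⟩ := h x (by simpa using hx)
  refine ⟨c, a, Submonoid.mem_powers a, ?_⟩
  have : algebraMap A K a ≠ 0 := by simpa using ha0
  rw [hc, Algebra.smul_def]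
  field_simp

/-- An element of a finitely generated module over a finite type algebra which survives in a
module that is finite-dimensional over the fraction field is sent to `1` by some linear form with
values in the localization of the base at a single nonzero element. -/
theorem exists_linearMap_ofField_powers_apply_eq_one {A : Type*} [CommRing A] [IsDomain A]
    (K : Type*) [Field K] [Algebra A K] [IsFractionRing A K]
    {B : Type*} [CommRing B] [Algebra A B] [Algebra.FiniteType A B]
    {M : Type*} [AddCommGroup M] [Module B M] [Module A M] [IsScalarTower A B M]
    [Module.Finite B M]
    {C : Type*} [CommRing C] [Algebra K C] [Algebra A C] [IsScalarTower A K C] (ψ : B →ₐ[A] C)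
    {V : Type*} [AddCommGroup V] [Module C V] [Module K V] [IsScalarTower K C V]
    [Module.Finite K V] (φ : M →+ V) (hφ : ∀ b x, φ (b • x) = ψ b • φ x)
    {m : M} (hm : φ m ≠ 0) :
    ∃ (a : A) (ha : a ≠ 0) (f : M →ₗ[A] Localization.subalgebra.ofField K (Submonoid.powers a)
        (powers_le_nonZeroDivisors_of_noZeroDivisors ha)), f m = 1 := by
  let b := Module.finBasis K V
  obtain ⟨i, hi⟩ : ∃ i, b.repr (φ m) i ≠ 0 := by
    by_contra! h
    exact hm (b.repr.map_eq_zero_iff.mp (Finsupp.ext h))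
  obtain ⟨s, hs⟩ := Algebra.FiniteType.out (R := A) (A := B)
  obtain ⟨t, ht⟩ := Module.Finite.fg_top (R := B) (M := M)
  let F : Set K := (⋃ β ∈ s, ⋃ j, Set.range (b.repr (ψ β • b j))) ∪
    (⋃ x ∈ t, Set.range (b.repr (φ x))) ∪ {(b.repr (φ m) i)⁻¹}
  have hF : F.Finite := by
    refine ((s.finite_toSet.biUnion fun β _ => Set.finite_iUnion fun j => Set.finite_range _).union
      (t.finite_toSet.biUnion fun x _ => Set.finite_range _)).union (Set.finite_singleton _)
  obtain ⟨a, ha, hFa⟩ := exists_ne_zero_and_subset_ofField_powers (A := A) K hF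
  refine ⟨a, ha, ?_⟩
  set R := Localization.subalgebra.ofField K (Submonoid.powers a)
    (powers_le_nonZeroDivisors_of_noZeroDivisors ha)
  have hψ : ∀ (β : B) (v : V), (∀ j, b.repr v j ∈ R) → ∀ j, b.repr (ψ β • v) j ∈ R := by
    intro β
    have hβ : β ∈ Algebra.adjoin A (s : Set B) := hs ▸ Algebra.mem_top
    induction hβ using Algebra.adjoin_induction with
    | mem β hβ =>
      intro v hv j
      have hsum : ψ β • v = ∑ l, b.repr v l • (ψ β • b l) := by
        conv_lhs => rw [← b.sum_repr v, Finset.smul_sum]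
        exact Finset.sum_congr rfl fun l _ => smul_algebra_smul_comm _ _ _
      rw [hsum]
      simp only [map_sum, map_smul, Finsupp.coe_finsetSum, Finset.sum_apply, Finsupp.smul_apply,
        smul_eq_mul]
      refine sum_mem fun l _ => mul_mem (hv l) (hFa (.inl (.inl ?_)))
      simp only [Set.mem_iUnion]
      exact ⟨β, hβ, l, j, rfl⟩
    | algebraMap r =>
      intro v hv j
      rw [AlgHom.commutes, IsScalarTower.algebraMap_apply A K C, algebraMap_smul, map_smul]
      exact mul_mem (R.algebraMap_mem r) (hv j)
    | add β γ _ _ h₁ h₂ =>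
      intro v hv j
      rw [map_add, add_smul, map_add]
      exact add_mem (h₁ v hv j) (h₂ v hv j)
    | mul β γ _ _ h₁ h₂ =>
      intro v hv
      rw [map_mul, mul_smul]
      exact h₁ _ (h₂ v hv)
  have hφR : ∀ x j, b.repr (φ x) j ∈ R := by
    intro x
    have hx : x ∈ Submodule.span B (t : Set M) := ht ▸ Submodule.mem_top
    induction hx using Submodule.span_induction with
    | mem x hx =>
      intro j
      refine hFa (.inl (.inr ?_))
      simp only [Set.mem_iUnion]
      exact ⟨x, hx, j, rfl⟩
    | zero => simp
    | add x y _ _ h₁ h₂ =>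
      intro j
      rw [map_add, map_add]
      exact add_mem (h₁ j) (h₂ j)
    | smul β x _ h =>
      rw [hφ]
      exact hψ β _ h
  refine ⟨{
    toFun := fun x => ⟨(b.repr (φ m) i)⁻¹ * b.repr (φ x) i,
      mul_mem (hFa (.inr rfl)) (hφR x i)⟩
    map_add' := fun x y => Subtype.ext (by simp [mul_add])
    map_smul' := fun r x => Subtype.ext ?_ }, Subtype.ext (inv_mul_cancel₀ hi)⟩
  have hr : φ (r • x) = algebraMap A K r • φ x := by
    rw [← algebraMap_smul B r x, hφ, AlgHom.commutes, IsScalarTower.algebraMap_apply A K C,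
      algebraMap_smul]
  simp [hr, Algebra.smul_def, mul_left_comm]

/-- If the image of `m` in `M ⊗ κ(p)` vanishes, no linear form on `M` with values in a
localization away from an element outside `p` sends `m` to `1`. -/
theorem apply_ne_one_of_tmul_one_fractionRing_eq_zero {A : Type*} [CommRing A]
    {M : Type*} [AddCommGroup M] [Module A M] {m : M} {p : Ideal A} [p.IsPrime]
    (hm : m ⊗ₜ[A] (1 : FractionRing (A ⧸ p)) = 0) {a : A} (ha : a ∉ p)
    {R : Type*} [CommRing R] [Algebra A R] [IsLocalization.Away a R] (f : M →ₗ[A] R) :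
    f m ≠ 1 := by
  intro hf
  have hunit : IsUnit (algebraMap A (FractionRing (A ⧸ p)) a) := by
    rw [isUnit_iff_ne_zero, IsScalarTower.algebraMap_apply A (A ⧸ p), Ne,
      FaithfulSMul.algebraMap_eq_zero_iff]
    exact fun h => ha (Ideal.Quotient.eq_zero_iff_mem.mp h)
  let g : R →ₐ[A] FractionRing (A ⧸ p) :=
    { IsLocalization.Away.lift a hunit with
      commutes' := fun r => IsLocalization.Away.lift_eq a hunit r }
  have h := congrArg (LinearMap.mul' A (FractionRing (A ⧸ p)))
    (congrArg (LinearMap.rTensor _ (g.toLinearMap ∘ₗ f)) hm)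
  simp [hf] at h

/-- Let `A` be a noetherian integral domain with fraction field `K`, let `B`
be a finite type `A`-algebra, let `M` be a finitely generated `B`-module (viewed as an
`A`-module via the structure map), and let `m ∈ M`. Suppose there is a set `S` of prime ideals
of `A` with `⋂_{p ∈ S} p = 0` such that, for every `p ∈ S`, the image of `m` under the natural
map `M → M ⊗[A] κ(p)` is zero, where `κ(p) = Frac(A ⧸ p)`. Then the image of `m` under the
natural map `M → M ⊗[A] K` is zero. -/
theorem tensor_fractionField_eq_zero_of_vanishing_on_dense_set_of_primes
    {A : Type*} [CommRing A] [IsDomain A] [IsNoetherianRing A]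
    (K : Type*) [Field K] [Algebra A K] [IsFractionRing A K]
    {B : Type*} [CommRing B] [Algebra A B] (hB : Algebra.FiniteType A B)
    {M : Type*} [AddCommGroup M] [Module B M] [Module A M] [IsScalarTower A B M]
    (hM : Module.Finite B M) (m : M)
    (S : Set (Ideal A)) (hprime : ∀ p ∈ S, p.IsPrime) (hS : sInf S = ⊥)
    (hvanish : ∀ p ∈ S,
      m ⊗ₜ[A] (1 : FractionRing (A ⧸ p)) = (0 : M ⊗[A] FractionRing (A ⧸ p))) :
    m ⊗ₜ[A] (1 : K) = (0 : M ⊗[A] K) := by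
  by_contra hne
  let : Algebra K (B ⊗[A] K) := Algebra.TensorProduct.rightAlgebra
  have : Algebra.FiniteType K (B ⊗[A] K) :=
    Algebra.FiniteType.equiv (inferInstanceAs (Algebra.FiniteType K (K ⊗[A] B)))
      { Algebra.TensorProduct.comm A K B with
        commutes' := fun _ => rfl }
  have : IsScalarTower A K (B ⊗[A] K) := Algebra.TensorProduct.right_isScalarTower
  let N := (B ⊗[A] K) ⊗[B] M
  have : SMulCommClass B K (B ⊗[A] K) :=
    ⟨fun b k c => by rw [Algebra.smul_def k, Algebra.smul_def k, mul_smul_comm]⟩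
  have hx : ((1 : B ⊗[A] K) ⊗ₜ[B] m : N) ≠ 0 := by
    intro h
    have h' := congrArg (AlgebraTensorModule.cancelBaseChange A B B M K)
      (congrArg (TensorProduct.comm B (B ⊗[A] K) M) h)
    rw [TensorProduct.comm_tmul, Algebra.TensorProduct.one_def,
      AlgebraTensorModule.cancelBaseChange_tmul, one_smul, map_zero, map_zero] at h'
    exact hne h'
  obtain ⟨Q, hQ, hfin⟩ := exists_notMem_and_finite_quotient_of_ne_zero
    (K := K) (C := B ⊗[A] K) (N := N) hx
  let φ : M →+ N ⧸ Q :=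
    Q.mkQ.toAddMonoidHom.comp (TensorProduct.mk B (B ⊗[A] K) M 1).toAddMonoidHom
  have hφ : ∀ (b : B) (x : M),
      φ (b • x) = (Algebra.TensorProduct.includeLeft : B →ₐ[A] B ⊗[A] K) b • φ x := by
    intro b x
    change Q.mkQ ((1 : B ⊗[A] K) ⊗ₜ[B] (b • x)) = (b ⊗ₜ[A] (1 : K)) • Q.mkQ (1 ⊗ₜ[B] x)
    rw [← map_smul, TensorProduct.smul_tmul', TensorProduct.tmul_smul, TensorProduct.smul_tmul',
      smul_eq_mul, mul_one, Algebra.TensorProduct.one_def, TensorProduct.smul_tmul', smul_eq_mul,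
      mul_one]
  have hφm : φ m ≠ 0 := fun h => hQ ((Submodule.Quotient.mk_eq_zero Q).mp h)
  obtain ⟨a, ha, f, hf⟩ := exists_linearMap_ofField_powers_apply_eq_one K
    (Algebra.TensorProduct.includeLeft : B →ₐ[A] B ⊗[A] K) (V := N ⧸ Q) φ hφ hφm
  obtain ⟨p, hp, hap⟩ : ∃ p ∈ S, a ∉ p := by
    by_contra! h
    exact ha (by simpa [hS] using Submodule.mem_sInf.mpr h)
  have := hprime p hp
  have := Localization.subalgebra.isLocalization_ofField K (Submonoid.powers a)
    (powers_le_nonZeroDivisors_of_noZeroDivisors ha)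
  exact apply_ne_one_of_tmul_one_fractionRing_eq_zero (hvanish p hp) hap f hf
end

section
/- Let A be a noetherian integral domain, and let B be a finite type A-algebra whose structure map A → B is injective. Assume that B has a unique minimal prime ideal and has no embedded primes. Let M be a finitely generated flat B-module and let m ∈ M. Suppose there is a set S of prime ideals of A with ⋂_{p ∈ S} p = 0 such that, for every p ∈ S, the image of m under the natural map M → M ⊗_A κ(p) is zero, where κ(p) is the fraction field of A/p. Then m = 0. -/
open TensorProduct

/-- `s` is a linearly independent subset of the submodule `N` that spans `N` after inverting `a`,
so that `s` is a basis of the localization `N[1/a]`. -/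
structure Submodule.IsBasisAway {A M : Type*} [CommRing A] [AddCommGroup M] [Module A M]
    (a : A) (N : Submodule A M) (s : Set M) : Prop where
  subset : s ⊆ N
  linearIndepOn : LinearIndepOn A id s
  exists_pow_smul_mem : ∀ x ∈ N, ∃ k : ℕ, a ^ k • x ∈ Submodule.span A s

namespace Submodule.IsBasisAway

section

variable {A M V Q : Type*} [CommRing A] [AddCommGroup M] [Module A M] [AddCommGroup V] [Module A V]
  [AddCommGroup Q] [Module A Q] {a : A} {N : Submodule A M} {s : Set M}

theorem of_dvd {b : A} (h : IsBasisAway a N s) (hab : a ∣ b) : IsBasisAway b N s := by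
  refine ⟨h.subset, h.linearIndepOn, fun x hx ↦ ?_⟩
  obtain ⟨k, hk⟩ := h.exists_pow_smul_mem x hx
  obtain ⟨c, rfl⟩ := hab
  refine ⟨k, ?_⟩
  rw [mul_pow, mul_comm, mul_smul]
  exact smul_mem _ _ hk

/-- Extending a basis away from `a` along an extension `N ⊆ N ⊔ range φ` whose quotient is
identified with `Q`. -/
theorem exists_sup_range (hs : IsBasisAway a N s) {φ : V →ₗ[A] M} {ψ : V →ₗ[A] Q}
    (hψ : Function.Surjective ψ) (hker : ψ.ker = N.comap φ) {t : Set Q}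
    (ht : IsBasisAway a ⊤ t) :
    ∃ s', s ⊆ s' ∧ IsBasisAway a (N ⊔ φ.range) s' := by
  let g := Function.surjInv hψ
  have hg : ∀ q, ψ (g q) = q := Function.surjInv_eq hψ
  let j : Q →ₗ[A] M ⧸ N := (ψ.ker.mapQ N φ hker.le).comp
    (ψ.quotKerEquivOfSurjective hψ).symm.toLinearMap
  have hj : ∀ v, j (ψ v) = N.mkQ (φ v) := by
    intro v
    have : (ψ.quotKerEquivOfSurjective hψ).symm (ψ v) = ψ.ker.mkQ v := by
      rw [LinearEquiv.symm_apply_eq]; rfl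
    simp [j, this]
  have hjinj : Function.Injective j := by
    rw [injective_iff_map_eq_zero]
    intro q hq
    obtain ⟨v, rfl⟩ := hψ q
    rw [hj, mkQ_apply, Quotient.mk_eq_zero] at hq
    rw [← LinearMap.mem_ker, hker]
    exact hq
  have hsup : (φ ∘ g) '' t ⊆ (N ⊔ φ.range : Submodule A M) := by
    rintro _ ⟨q, -, rfl⟩
    exact mem_sup_right ⟨_, rfl⟩
  refine ⟨s ∪ (φ ∘ g) '' t, Set.subset_union_left,
    Set.union_subset (hs.subset.trans (SetLike.coe_subset_coe.2 le_sup_left)) hsup, ?_, ?_⟩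
  · refine LinearIndepOn.union_id_of_quotient hs.subset hs.linearIndepOn
      (LinearIndepOn.image_of_comp _ _ ?_)
    have h := ht.linearIndepOn.map_injOn j hjinj.injOn
    convert! h using 1
    ext q
    simp [← hj, hg]
  · intro x hx
    obtain ⟨n, hn, _, ⟨v, rfl⟩, rfl⟩ := mem_sup.1 hx
    obtain ⟨k, hk⟩ := ht.exists_pow_smul_mem (ψ v) trivial
    have himage : t = ψ '' (g '' t) := by simp [Set.image_image, hg]
    rw [himage, ← map_span] at hk
    obtain ⟨w, hw, hwv⟩ := hk
    have hmem : a ^ k • v - w ∈ ψ.ker := by simp [hwv]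
    rw [hker, mem_comap] at hmem
    obtain ⟨l, hl⟩ := hs.exists_pow_smul_mem _ (add_mem (N.smul_mem (a ^ k) hn) hmem)
    refine ⟨l + k, ?_⟩
    have hφw : φ w ∈ span A (s ∪ (φ ∘ g) '' t) := by
      have := mem_map_of_mem (f := φ) hw
      rw [map_span, ← Set.image_comp] at this
      exact span_mono Set.subset_union_right this
    have heq : a ^ (l + k) • (n + φ v) =
        a ^ l • (a ^ k • n + φ (a ^ k • v - w)) + a ^ l • φ w := by
      rw [pow_add, mul_smul, ← smul_add, add_assoc, map_sub, sub_add_cancel, map_smul, smul_add]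
    rw [heq]
    exact add_mem (span_mono Set.subset_union_left hl) (smul_mem _ _ hφw)

theorem exists_iSup {N : ℕ → Submodule A M} (hN : Monotone N) (hs : IsBasisAway a (N 0) s)
    (hstep : ∀ k s, IsBasisAway a (N k) s → ∃ s', s ⊆ s' ∧ IsBasisAway a (N (k + 1)) s') :
    ∃ s', IsBasisAway a (⨆ k, N k) s' := by
  choose! f hf hf' using hstep
  let u : ℕ → Set M := fun n ↦ Nat.rec s f n
  have hu : ∀ k, IsBasisAway a (N k) (u k) := fun k ↦ by
    induction k with
    | zero => exact hs
    | succ k ih => exact hf' k _ ih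
  have hmono : Monotone u := monotone_nat_of_le_succ fun k ↦ hf k _ (hu k)
  refine ⟨⋃ k, u k, Set.iUnion_subset fun k ↦ (hu k).subset.trans
    (SetLike.coe_subset_coe.2 (le_iSup N k)),
    linearIndepOn_iUnion_of_directed hmono.directed_le fun k ↦ (hu k).linearIndepOn, ?_⟩
  intro x hx
  obtain ⟨k, hk⟩ := (mem_iSup_of_directed _ hN.directed_le).1 hx
  obtain ⟨l, hl⟩ := (hu k).exists_pow_smul_mem x hk
  exact ⟨l, span_mono (Set.subset_iUnion u k) hl⟩

theorem exists_of_finite (A M : Type*) [CommRing A] [IsDomain A] [AddCommGroup M] [Module A M]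
    [Module.Finite A M] : ∃ a : A, a ≠ 0 ∧ ∃ s : Set M, IsBasisAway a ⊤ s := by
  classical
  obtain ⟨s, hs, hmax⟩ := exists_maximal_linearIndepOn A (id : M → M)
  have hmax' : ∀ x : M, ∃ b : A, b ≠ 0 ∧ b • x ∈ span A s := by
    intro x
    by_cases hx : x ∈ s
    · exact ⟨1, one_ne_zero, by simpa using subset_span hx⟩
    · simpa using hmax x hx
  choose b hb0 hb using hmax'
  obtain ⟨G, hG⟩ := Module.Finite.fg_top (R := A) (M := M)
  refine ⟨∏ x ∈ G, b x, Finset.prod_ne_zero_iff.2 fun x _ ↦ hb0 x, s, Set.subset_univ s, hs, ?_⟩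
  intro x hx
  refine ⟨1, ?_⟩
  rw [pow_one]
  have hle : span A (G : Set M) ≤ (span A s).comap (LinearMap.lsmul A M (∏ x ∈ G, b x)) := by
    refine span_le.2 fun y hy ↦ ?_
    obtain ⟨c, hc⟩ := Finset.dvd_prod_of_mem b hy
    change (∏ x ∈ G, b x) • y ∈ span A s
    rw [hc, mul_comm, mul_smul]
    exact smul_mem _ _ (hb y)
  exact hle (hG ▸ hx)

/-- A basis away from `a` is detected on the fibres over any dense set of primes. -/
theorem exists_pow_smul_eq_zero [IsDomain A] (hs : IsBasisAway a (⊤ : Submodule A M) s)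
    (ha : a ≠ 0) (S : Set (Ideal A)) (hprime : ∀ p ∈ S, p.IsPrime) (hS : sInf S = ⊥) {m : M}
    (hm : ∀ p ∈ S, m ⊗ₜ[A] (1 : FractionRing (A ⧸ p)) = (0 : M ⊗[A] FractionRing (A ⧸ p))) :
    ∃ k : ℕ, a ^ k • m = 0 := by
  let L := Localization.Away a
  let f := LocalizedModule.mkLinearMap (Submonoid.powers a) M
  have hli : LinearIndependent L (f ∘ ((↑) : s → M)) :=
    LinearIndependent.of_isLocalizedModule L (Submonoid.powers a) f hs.linearIndepOn
  have hspan : ⊤ ≤ span L (Set.range (f ∘ ((↑) : s → M))) := by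
    rw [Set.range_comp, Subtype.range_coe]
    rintro y -
    obtain ⟨⟨x, c⟩, hxc⟩ := IsLocalizedModule.surj (Submonoid.powers a) f y
    obtain ⟨k, hk⟩ := hs.exists_pow_smul_mem x trivial
    have hfx : f (a ^ k • x) ∈ span L (f '' s) := by
      have := mem_map_of_mem (f := f) hk
      rw [map_span] at this
      exact span_subset_span A L _ this
    have hu : IsUnit (algebraMap A L (a ^ k * c)) :=
      IsLocalization.map_units L
        (⟨a ^ k, k, rfl⟩ * c : Submonoid.powers a)
    have hxc' : algebraMap A L (a ^ k * c) • y = f (a ^ k • x) := by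
      rw [algebraMap_smul, mul_smul, map_smul]
      exact congrArg _ hxc
    rw [← hxc'] at hfx
    exact ((span L (f '' s)).smul_mem_iff_of_isUnit hu).1 hfx
  let b := Module.Basis.mk hli hspan
  obtain ⟨k, hk⟩ := hs.exists_pow_smul_mem m trivial
  refine ⟨k, ?_⟩
  obtain ⟨c, hc⟩ := (Finsupp.mem_span_iff_linearCombination A s _).1 hk
  have hc0 : c = 0 := by
    ext i
    rw [Finsupp.zero_apply]
    suffices h : a * c i ∈ sInf S by
      rw [hS, mem_bot] at h
      exact (mul_eq_zero.1 h).resolve_left ha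
    rw [mem_sInf]
    intro p hp
    have := hprime p hp
    by_cases hap : a ∈ p
    · exact Ideal.mul_mem_right _ p hap
    refine Ideal.mul_mem_left p _ ?_
    let K := FractionRing (A ⧸ p)
    have hinj : Function.Injective (algebraMap (A ⧸ p) K) := IsFractionRing.injective _ _
    have hK : ∀ x, algebraMap A K x = 0 ↔ x ∈ p := by
      intro x
      rw [IsScalarTower.algebraMap_apply A (A ⧸ p) K, map_eq_zero_iff _ hinj]
      exact Ideal.Quotient.eq_zero_iff_mem
    have hunit : ∀ y : Submonoid.powers a, IsUnit (Algebra.ofId A K y) := by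
      rintro ⟨_, n, rfl⟩
      rw [Algebra.ofId_apply, map_pow]
      exact (isUnit_iff_ne_zero.2 ((hK a).not.2 hap)).pow n
    let θ : L →ₐ[A] K := IsLocalization.liftAlgHom (M := Submonoid.powers a)
      (f := Algebra.ofId A K) hunit
    let F : M →ₗ[A] K :=
      θ.toLinearMap ∘ₗ ((b.coord i).restrictScalars A) ∘ₗ f
    have hF : F m = 0 := by
      have := congrArg (TensorProduct.lift ((LinearMap.mul A K).comp F)) (hm p hp)
      simpa using this
    have hFc : F (a ^ k • m) = algebraMap A K (c i) := by
      have hb : ∀ i : s, f i = b i := fun i ↦ by simp [b]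
      have : f (a ^ k • m) = Finsupp.linearCombination L b
          (c.mapRange (algebraMap A L) (map_zero _)) := by
        rw [← hc, Finsupp.linearCombination_apply, Finsupp.linearCombination_apply, map_finsuppSum,
          Finsupp.sum_mapRange_index (by simp)]
        simp [hb]
      simp only [F, LinearMap.comp_apply, this]
      simp
    rw [← hK, ← hFc, map_smul, hF, smul_zero]
  rw [← hc, hc0, map_zero]

end

end Submodule.IsBasisAway

open Polynomial

/-- Generic freeness for finite modules in the universe `v` over the `A`-algebra `R`. -/
def IsGenericallyFree.{v, u, w} (A : Type u) (R : Type w) [CommRing A] [CommRing R]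
    [Algebra A R] : Prop :=
  ∀ (M : Type v) [AddCommGroup M] [Module R M] [Module A M] [IsScalarTower A R M]
    [Module.Finite R M], ∃ a : A, a ≠ 0 ∧ ∃ s : Set M, Submodule.IsBasisAway a ⊤ s

namespace IsGenericallyFree

universe v

variable {A R S : Type*} [CommRing A] [CommRing R] [CommRing S] [Algebra A R] [Algebra A S]

theorem of_surjective (h : IsGenericallyFree.{v} A R) (f : R →ₐ[A] S)
    (hf : Function.Surjective f) : IsGenericallyFree.{v} A S := by
  intro M _ _ _ _ _
  let := f.toRingHom.toAlgebra
  let := Module.compHom M f.toRingHom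
  have : IsScalarTower R S M := ⟨fun r s x ↦ mul_smul (f r) s x⟩
  have : IsScalarTower A R M := ⟨fun a r x ↦ by
    change f (a • r) • x = a • f r • x
    rw [map_smul, smul_assoc]⟩
  have : Module.Finite R S := Module.Finite.of_surjective (Algebra.linearMap R S) hf
  have : Module.Finite R M := Module.Finite.trans S M
  exact h M

theorem polynomial [IsDomain A] [IsNoetherianRing R] (h : IsGenericallyFree.{v} A R) :
    IsGenericallyFree.{v} A R[X] := by
  intro M _ _ _ _ _
  let := Module.compHom M (C : R →+* R[X])
  have : IsScalarTower R R[X] M := ⟨fun r q x ↦ by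
    change (r • q) • x = C r • q • x
    rw [smul_eq_C_mul, mul_smul]⟩
  have : IsScalarTower A R M := IsScalarTower.of_algebraMap_smul fun a x ↦ by
    change C (algebraMap A R a) • x = a • x
    exact algebraMap_smul R[X] a x
  obtain ⟨G, hG⟩ := Module.Finite.fg_top (R := R[X]) (M := M)
  let V : Submodule R M := Submodule.span R G
  have : Module.Finite R V := Module.Finite.span_of_finite R G.finite_toSet
  let ξ : Module.End R M := Module.toModuleEnd R M (X : R[X])
  have hξ : ∀ (n : ℕ) x, (ξ ^ n) x = (X : R[X]) ^ n • x := by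
    intro n x
    rw [← map_pow]
    rfl
  let φ : ℕ → V →ₗ[R] M := fun k ↦ (ξ ^ k).comp V.subtype
  let N : ℕ → Submodule R M := fun n ↦ Nat.rec ⊥ (fun k N ↦ N ⊔ (φ k).range) n
  have hNsucc : ∀ k, N (k + 1) = N k ⊔ (φ k).range := fun k ↦ rfl
  have hNmono : Monotone N := monotone_nat_of_le_succ fun k ↦ hNsucc k ▸ le_sup_left
  have hNξ : ∀ k, N k ≤ (N (k + 1)).comap ξ := by
    intro k
    induction k with
    | zero => exact bot_le
    | succ k ih =>
      rw [hNsucc k]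
      refine sup_le (ih.trans (Submodule.comap_mono (hNmono (Nat.le_succ (k + 1))))) ?_
      rintro _ ⟨v, rfl⟩
      rw [Submodule.mem_comap, hNsucc (k + 1)]
      refine Submodule.mem_sup_right ⟨v, ?_⟩
      simp only [φ, LinearMap.comp_apply, pow_succ', Module.End.mul_apply]
  have hNtop : ⨆ k, N k = ⊤ := by
    let W : Submodule R[X] M :=
      { (⨆ k, N k).toAddSubmonoid with
        smul_mem' := by
          intro q x hx
          have hX : ∀ y ∈ ⨆ k, N k, (X : R[X]) • y ∈ ⨆ k, N k := by
            intro y hy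
            obtain ⟨k, hk⟩ := (Submodule.mem_iSup_of_directed _ hNmono.directed_le).1 hy
            exact Submodule.mem_iSup_of_mem (k + 1) (hNξ k hk)
          change x ∈ ⨆ k, N k at hx
          change q • x ∈ ⨆ k, N k
          have hXn : ∀ n : ℕ, (X : R[X]) ^ n • x ∈ ⨆ k, N k := by
            intro n
            induction n with
            | zero => simpa using hx
            | succ n ih =>
              rw [pow_succ', mul_smul]
              exact hX _ ih
          induction q using Polynomial.induction_on' with
          | add p q hp hq =>
            rw [add_smul]
            exact add_mem hp hq
          | monomial n r =>
            rw [← C_mul_X_pow_eq_monomial, mul_smul]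
            exact Submodule.smul_mem (⨆ k, N k) r (hXn n) }
    have hW : W = ⊤ := by
      rw [eq_top_iff, ← hG]
      refine Submodule.span_le.2 fun x hx ↦ ?_
      change x ∈ ⨆ k, N k
      refine Submodule.mem_iSup_of_mem 1
        (Submodule.mem_sup_right ⟨⟨x, Submodule.subset_span hx⟩, ?_⟩)
      simp [φ]
    rw [eq_top_iff]
    intro x _
    have hx : x ∈ W := hW ▸ Submodule.mem_top
    exact hx
  let L : ℕ →o Submodule R V :=
    { toFun := fun k ↦ (N k).comap (φ k)
      monotone' := monotone_nat_of_le_succ fun k v hv ↦ by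
        have := hNξ k hv
        simpa only [φ, LinearMap.comp_apply, pow_succ', Module.End.mul_apply,
          Submodule.mem_comap] using this }
  obtain ⟨n, hn⟩ := monotone_stabilizes_iff_noetherian.2 (inferInstance : IsNoetherian R V) L
  choose a ha0 ha using fun k ↦ h (V ⧸ L k)
  choose t ht using ha
  let d := ∏ k ∈ Finset.range (n + 1), a k
  have hd : ∀ k, ∃ t : Set (V ⧸ L k), Submodule.IsBasisAway d ⊤ t := by
    intro k
    rcases le_total k n with hk | hk
    · exact ⟨t k, (ht k).of_dvd (Finset.dvd_prod_of_mem a (by simpa [Nat.lt_succ_iff] using hk))⟩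
    · rw [← hn k hk]
      exact ⟨t n, (ht n).of_dvd (Finset.dvd_prod_of_mem a (by simp))⟩
  refine ⟨d, Finset.prod_ne_zero_iff.2 fun k _ ↦ ha0 k, ?_⟩
  have key := Submodule.IsBasisAway.exists_iSup (a := d) (s := ∅)
    (N := fun k ↦ (N k).restrictScalars A) (fun i j hij ↦ hNmono hij)
    ⟨Set.empty_subset _, linearIndepOn_empty _ _, ?_⟩ ?_
  · obtain ⟨s, hs⟩ := key
    refine ⟨s, ?_⟩
    convert hs
    symm
    rw [eq_top_iff]
    intro x _
    have hx : x ∈ ⨆ k, N k := hNtop ▸ Submodule.mem_top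
    obtain ⟨k, hk⟩ := (Submodule.mem_iSup_of_directed _ hNmono.directed_le).1 hx
    exact Submodule.mem_iSup_of_mem k hk
  · rintro x (hx : x ∈ (⊥ : Submodule R M))
    exact ⟨0, by simp [(Submodule.mem_bot R).1 hx]⟩
  · intro k s hs
    obtain ⟨t, ht⟩ := hd k
    have := hs.exists_sup_range (φ := (φ k).restrictScalars A)
      (ψ := (L k).mkQ.restrictScalars A) (L k).mkQ_surjective
      (by ext v; simp [L]) ht
    convert this using 4
    rw [hNsucc]
    ext x
    simp [Submodule.mem_sup]

theorem self (A : Type*) [CommRing A] [IsDomain A] : IsGenericallyFree.{v} A A := by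
  intro M _ inst₁ inst₂ tower _
  obtain rfl : inst₁ = inst₂ := Module.ext' _ _ fun r x ↦ by
    have h := tower.smul_assoc r 1 x
    rw [smul_eq_mul, mul_one] at h
    exact h.trans (congrArg _ (inst₁.one_smul x))
  exact Submodule.IsBasisAway.exists_of_finite A M

theorem mvPolynomial [IsDomain A] [IsNoetherianRing A] (n : ℕ) :
    IsGenericallyFree.{v} A (MvPolynomial (Fin n) A) := by
  induction n with
  | zero =>
    exact (self A).of_surjective (Algebra.ofId _ _) (MvPolynomial.C_surjective (Fin 0))
  | succ n ih =>
    exact ih.polynomial.of_surjective (MvPolynomial.finSuccEquiv A n).symm.toAlgHom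
      (MvPolynomial.finSuccEquiv A n).symm.surjective

theorem of_finiteType [IsDomain A] [IsNoetherianRing A] [Algebra.FiniteType A R] :
    IsGenericallyFree.{v} A R := by
  obtain ⟨n, f, hf⟩ := Algebra.FiniteType.iff_quotient_mvPolynomial''.1 ‹Algebra.FiniteType A R›
  exact (mvPolynomial n).of_surjective f hf

end IsGenericallyFree

theorem algebraMap_mem_nonZeroDivisors_of_existsUnique_minimalPrimes {A B : Type*} [CommRing A]
    [IsDomain A] [CommRing B] [IsNoetherianRing B] [Algebra A B]
    (hinj : Function.Injective (algebraMap A B)) (hmin : ∃! P : Ideal B, P ∈ minimalPrimes B)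
    (hemb : ∀ P ∈ associatedPrimes B B, P ∈ minimalPrimes B) {a : A} (ha : a ≠ 0) :
    algebraMap A B a ∈ nonZeroDivisors B := by
  by_contra h
  have hmem : algebraMap A B a ∈ ((nonZeroDivisors B : Set B)ᶜ) := h
  rw [← biUnion_associatedPrimes_eq_compl_nonZeroDivisors] at hmem
  simp only [Set.mem_iUnion] at hmem
  obtain ⟨P, hP, haP⟩ := hmem
  have hrad : P = nilradical B := by
    have hset : minimalPrimes B = {P} :=
      Set.eq_singleton_iff_unique_mem.2
        ⟨hemb P hP, fun Q hQ ↦ hmin.unique hQ (hemb P hP)⟩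
    rw [nilradical, Ideal.zero_eq_bot, ← Ideal.sInf_minimalPrimes]
    change P = sInf (minimalPrimes B)
    rw [hset, sInf_singleton]
  rw [hrad] at haP
  obtain ⟨n, hn⟩ := mem_nilradical.1 haP
  rw [← map_pow, map_eq_zero_iff _ hinj] at hn
  exact ha (eq_zero_of_pow_eq_zero hn)

/-- Let `A` be a noetherian integral domain, and let `B` be a finite type
`A`-algebra whose structure map `A → B` is injective. Assume that `B` has a unique minimal
prime ideal and has no embedded primes. Let `M` be a finitely generated flat `B`-module and
`m ∈ M`. Suppose there is a set `S` of prime ideals of `A` with `⋂_{p ∈ S} p = 0` such that,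
for every `p ∈ S`, the image of `m` under the natural map `M → M ⊗[A] κ(p)` is zero, where
`κ(p) = Frac(A ⧸ p)`. Then `m = 0`. -/
theorem eq_zero_of_vanishing_on_dense_set_of_primes
    {A : Type*} [CommRing A] [IsDomain A] [IsNoetherianRing A]
    {B : Type*} [CommRing B] [Algebra A B]
    (hinj : Function.Injective (algebraMap A B)) (hB : Algebra.FiniteType A B)
    (hmin : ∃! P : Ideal B, P ∈ minimalPrimes B)
    (hemb : ∀ P ∈ associatedPrimes B B, P ∈ minimalPrimes B)
    {M : Type*} [AddCommGroup M] [Module B M] [Module A M] [IsScalarTower A B M]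
    (hfin : Module.Finite B M) (hflat : Module.Flat B M) (m : M)
    (S : Set (Ideal A)) (hprime : ∀ p ∈ S, p.IsPrime) (hS : sInf S = ⊥)
    (hvanish : ∀ p ∈ S,
      m ⊗ₜ[A] (1 : FractionRing (A ⧸ p)) = (0 : M ⊗[A] FractionRing (A ⧸ p))) :
    m = 0 := by
  have : IsNoetherianRing B := Algebra.FiniteType.isNoetherianRing A B
  obtain ⟨a, ha, s, hs⟩ := IsGenericallyFree.of_finiteType (A := A) (R := B) M
  obtain ⟨k, hk⟩ := hs.exists_pow_smul_eq_zero ha S hprime hS hvanish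
  have hreg : IsSMulRegular M (algebraMap A B (a ^ k)) :=
    Module.Flat.isSMulRegular_of_nonZeroDivisors
      (algebraMap_mem_nonZeroDivisors_of_existsUnique_minimalPrimes hinj hmin hemb
        (pow_ne_zero k ha))
  exact hreg.right_eq_zero_of_smul (by rwa [algebraMap_smul])
end
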